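/- For n = 4, let f = −x_{14}x_{21}x_{33}x_{42} + x_{11}x_{23}x_{34}x_{42} + x_{14}x_{22}x_{31}x_{43} − x_{11}x_{22}x_{34}x_{43} − x_{12}x_{23}x_{31}x_{44} + x_{12}x_{21}x_{33}x_{44} and Δ = det X. Then the product f·Δ lies in the ideal P_3 generated by the four principal 3-minors of X. -/

import Mathlib

open Matrix

/-- The generic `n × n` matrix whose entries are the variables `x i j` of the
polynomial ring `K[X]`. -/
noncomputable def genMat (K : Type*) [Field K] (n : ℕ) :
    Matrix (Fin n) (Fin n) (MvPolynomial (Fin n × Fin n) K) :=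
  fun i j => MvPolynomial.X (i, j)

/-- `P_t`: the ideal generated by the principal `t`-minors of the generic matrix,
i.e. the determinants of the submatrices whose rows and columns are both indexed by
a subset `s` of cardinality `t`. -/
noncomputable def prinMinorIdeal (K : Type*) [Field K] (n t : ℕ) :
    Ideal (MvPolynomial (Fin n × Fin n) K) :=
  Ideal.span {p | ∃ s : Finset (Fin n), s.card = t ∧
    p = ((genMat K n).submatrix (fun i : {x // x ∈ s} => (i : Fin n))
        (fun j : {x // x ∈ s} => (j : Fin n))).det}

/-- The degree-4 polynomial
`f = −x₁₄x₂₁x₃₃x₄₂ + x₁₁x₂₃x₃₄x₄₂ + x₁₄x₂₂x₃₁x₄₃ − x₁₁x₂₂x₃₄x₄₃ − x₁₂x₂₃x₃₁x₄₄ + x₁₂x₂₁x₃₃x₄₄`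
(indices written 1-based; here `Fin 4` is 0-based). -/
noncomputable def fpoly (K : Type*) [Field K] : MvPolynomial (Fin 4 × Fin 4) K :=
  - MvPolynomial.X ((0 : Fin 4), (3 : Fin 4)) * MvPolynomial.X (1, 0) *
      MvPolynomial.X (2, 2) * MvPolynomial.X (3, 1)
  + MvPolynomial.X (0, 0) * MvPolynomial.X (1, 2) *
      MvPolynomial.X (2, 3) * MvPolynomial.X (3, 1)
  + MvPolynomial.X (0, 3) * MvPolynomial.X (1, 1) *
      MvPolynomial.X (2, 0) * MvPolynomial.X (3, 2)
  - MvPolynomial.X (0, 0) * MvPolynomial.X (1, 1) *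
      MvPolynomial.X (2, 3) * MvPolynomial.X (3, 2)
  - MvPolynomial.X (0, 1) * MvPolynomial.X (1, 2) *
      MvPolynomial.X (2, 0) * MvPolynomial.X (3, 3)
  + MvPolynomial.X (0, 1) * MvPolynomial.X (1, 0) *
      MvPolynomial.X (2, 2) * MvPolynomial.X (3, 3)

/-- The principal minor of size `t` along an injective family of indices lies in `P_t`. -/
theorem det_submatrix_mem_prinMinorIdeal (K : Type*) [Field K] {n t : ℕ} {e : Fin t → Fin n}
    (he : Function.Injective e) : ((genMat K n).submatrix e e).det ∈ prinMinorIdeal K n t := by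
  refine Ideal.subset_span ⟨Finset.univ.map ⟨e, he⟩, by simp, ?_⟩
  let g : Fin t ≃ {x // x ∈ Finset.univ.map ⟨e, he⟩} :=
    Equiv.ofBijective (fun i => ⟨e i, by simp⟩)
      ⟨fun i j h => he (congrArg Subtype.val h), fun ⟨x, hx⟩ => by simpa using hx⟩
  rw [← det_submatrix_equiv_self g, submatrix_submatrix]
  rfl

/-- The product of `f` and the determinant of a `4 × 4` matrix, as a combination of its four
principal `3`-minors. -/
theorem fpoly_mul_det_eq_combination {R : Type*} [CommRing R]
    (a00 a01 a02 a03 a10 a11 a12 a13 a20 a21 a22 a23 a30 a31 a32 a33 : R) :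
    (-a03 * a10 * a22 * a31 + a00 * a12 * a23 * a31 + a03 * a11 * a20 * a32
      - a00 * a11 * a23 * a32 - a01 * a12 * a20 * a33 + a01 * a10 * a22 * a33) *
      !![a00, a01, a02, a03; a10, a11, a12, a13; a20, a21, a22, a23; a30, a31, a32, a33].det =
      (-a00 * a00 * a12 * a21 * a33 + a00 * a00 * a12 * a23 * a31 + a00 * a01 * a12 * a20 * a33
        - a00 * a01 * a12 * a23 * a30 + a00 * a02 * a10 * a21 * a33 - a00 * a02 * a10 * a23 * a31
        - a00 * a03 * a12 * a20 * a31 + a00 * a03 * a12 * a21 * a30 - a01 * a02 * a10 * a20 * a33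
        + a01 * a02 * a10 * a23 * a30 + a02 * a03 * a10 * a20 * a31 - a02 * a03 * a10 * a21 * a30) *
        !![a11, a12, a13; a21, a22, a23; a31, a32, a33].det +
      (-a00 * a11 * a11 * a23 * a32 + a00 * a11 * a12 * a23 * a31 + a00 * a11 * a13 * a21 * a32
        - a00 * a12 * a13 * a21 * a31 + a01 * a10 * a11 * a23 * a32 - a01 * a10 * a12 * a23 * a31
        - a01 * a11 * a13 * a20 * a32 + a01 * a12 * a13 * a20 * a31 - a03 * a10 * a11 * a21 * a32
        + a03 * a10 * a12 * a21 * a31 + a03 * a11 * a11 * a20 * a32 - a03 * a11 * a12 * a20 * a31) *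
        !![a00, a02, a03; a20, a22, a23; a30, a32, a33].det +
      (a01 * a10 * a22 * a22 * a33 - a01 * a10 * a22 * a23 * a32 - a01 * a12 * a20 * a22 * a33
        + a01 * a12 * a20 * a23 * a32 - a02 * a10 * a21 * a22 * a33 + a02 * a10 * a22 * a23 * a31
        + a02 * a12 * a20 * a21 * a33 - a02 * a12 * a20 * a23 * a31 + a03 * a10 * a21 * a22 * a32
        - a03 * a10 * a22 * a22 * a31 - a03 * a12 * a20 * a21 * a32 + a03 * a12 * a20 * a22 * a31) *
        !![a00, a01, a03; a10, a11, a13; a30, a31, a33].det +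
      (a00 * a12 * a21 * a33 * a33 - a00 * a12 * a23 * a31 * a33 - a00 * a13 * a21 * a32 * a33
        + a00 * a13 * a23 * a31 * a32 - a01 * a12 * a20 * a33 * a33 + a01 * a12 * a23 * a30 * a33
        + a01 * a13 * a20 * a32 * a33 - a01 * a13 * a23 * a30 * a32 + a03 * a12 * a20 * a31 * a33
        - a03 * a12 * a21 * a30 * a33 - a03 * a13 * a20 * a31 * a32 + a03 * a13 * a21 * a30 * a32) *
        !![a00, a01, a02; a10, a11, a12; a20, a21, a22].det := by
  simp [det_fin_three, det_succ_row_zero (n := 3), Fin.sum_univ_four, Fin.succAbove]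
  ring

/-- For `n = 4`, the product `f·Δ` of the degree-4 polynomial `f` with the
determinant `Δ = det X` lies in the ideal `P₃` generated by the four principal
3-minors of `X`. -/
theorem fpoly_mul_det_mem_prinMinorIdeal (K : Type*) [Field K] [IsAlgClosed K] :
    fpoly K * (genMat K 4).det ∈ prinMinorIdeal K 4 3 := by
  have hX : genMat K 4 = of ![![genMat K 4 0 0, genMat K 4 0 1, genMat K 4 0 2, genMat K 4 0 3],
      ![genMat K 4 1 0, genMat K 4 1 1, genMat K 4 1 2, genMat K 4 1 3],
      ![genMat K 4 2 0, genMat K 4 2 1, genMat K 4 2 2, genMat K 4 2 3],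
      ![genMat K 4 3 0, genMat K 4 3 1, genMat K 4 3 2, genMat K 4 3 3]] :=
    (etaExpand_eq _).symm
  have key := fpoly_mul_det_eq_combination (genMat K 4 0 0) (genMat K 4 0 1) (genMat K 4 0 2)
    (genMat K 4 0 3) (genMat K 4 1 0) (genMat K 4 1 1) (genMat K 4 1 2) (genMat K 4 1 3)
    (genMat K 4 2 0) (genMat K 4 2 1) (genMat K 4 2 2) (genMat K 4 2 3) (genMat K 4 3 0)
    (genMat K 4 3 1) (genMat K 4 3 2) (genMat K 4 3 3)
  rw [← hX] at key
  refine (congrArg (· ∈ prinMinorIdeal K 4 3) key).mpr ?_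
  refine add_mem (add_mem (add_mem ?_ ?_) ?_) ?_ <;> refine Ideal.mul_mem_left _ _ ?_
  · convert det_submatrix_mem_prinMinorIdeal K (n := 4) (e := ![1, 2, 3]) (by decide) using 2
    ext i j; fin_cases i <;> fin_cases j <;> rfl
  · convert det_submatrix_mem_prinMinorIdeal K (n := 4) (e := ![0, 2, 3]) (by decide) using 2
    ext i j; fin_cases i <;> fin_cases j <;> rfl
  · convert det_submatrix_mem_prinMinorIdeal K (n := 4) (e := ![0, 1, 3]) (by decide) using 2
    ext i j; fin_cases i <;> fin_cases j <;> rfl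
  · convert det_submatrix_mem_prinMinorIdeal K (n := 4) (e := ![0, 1, 2]) (by decide) using 2
    ext i j; fin_cases i <;> fin_cases j <;> rfl
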